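/- arXiv:2012.10001 — 2 statements merged into one kernel-verified Lean document; each statement's English description precedes it below -/
import Mathlib

section
/- Let W : ℝ → ℝ be strictly increasing and continuously differentiable with W(x) ≥ 0 for all x, x·W(x) → 0 as x → −∞, and closure of range equal to [0, B] for some 0 < B < ∞. Define the second-price cost f(x) := 1_{x ≥ 0} ∫_0^x u W'(u) du and the acquisition cost Λ(s) := f(W^{−1}(s)) for s ∈ (0, B). Then: (i) Λ(s) = 1_{s ≥ W(0)} ∫_{W(0)}^{s} W^{−1}(y) dy for all s ∈ (0, B); (ii) Λ(s) = 0 for all s ≤ W(0), and Λ(s) → 0 as s → 0⁺; (iii) Λ is continuously differentiable on (0, B) with Λ'(s) = 1_{s ≥ W(0)}·W^{−1}(s); and (iv) Λ is convex and nondecreasing on (0, B). -/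
open MeasureTheory Filter

section RangeClosure

variable {W : ℝ → ℝ} {B : ℝ}

lemma StrictMono.mem_Ioo_of_closure_range (hW : StrictMono W)
    (hrange : closure (Set.range W) = Set.Icc 0 B) (x : ℝ) : W x ∈ Set.Ioo 0 B := by
  have hmem : ∀ y, W y ∈ Set.Icc 0 B := fun y => hrange ▸ subset_closure ⟨y, rfl⟩
  exact ⟨(hmem (x - 1)).1.trans_lt (hW (sub_one_lt x)),
    (hW (lt_add_one x)).trans_le (hmem (x + 1)).2⟩

lemma apply_invFun_of_closure_range (hcont : Continuous W)
    (hrange : closure (Set.range W) = Set.Icc 0 B) {s : ℝ} (hs : s ∈ Set.Ioo 0 B) :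
    W (Function.invFun W s) = s := by
  have hB : 0 ≤ B := (hs.1.trans hs.2).le
  have hzero : (0 : ℝ) ∈ closure (Set.range W) := by simp [hrange, hB]
  have htop : B ∈ closure (Set.range W) := by simp [hrange, hB]
  obtain ⟨_, ha, ⟨a, rfl⟩⟩ := mem_closure_iff.1 hzero _ isOpen_Iio hs.1
  obtain ⟨_, hb, ⟨b, rfl⟩⟩ := mem_closure_iff.1 htop _ isOpen_Ioi hs.2
  exact Function.invFun_eq
    (mem_range_of_exists_le_of_exists_ge hcont ⟨a, le_of_lt ha⟩ ⟨b, le_of_lt hb⟩)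

lemma StrictMono.strictMonoOn_invFun (hW : StrictMono W) (hcont : Continuous W)
    (hrange : closure (Set.range W) = Set.Icc 0 B) :
    StrictMonoOn (Function.invFun W) (Set.Ioo 0 B) := by
  intro s hs t ht hst
  rw [← hW.lt_iff_lt, apply_invFun_of_closure_range hcont hrange hs,
    apply_invFun_of_closure_range hcont hrange ht]
  exact hst

lemma StrictMono.continuousOn_invFun (hW : StrictMono W) (hcont : Continuous W)
    (hrange : closure (Set.range W) = Set.Icc 0 B) :
    ContinuousOn (Function.invFun W) (Set.Ioo 0 B) := by
  have himage : Function.invFun W '' Set.Ioo 0 B = Set.univ :=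
    Set.eq_univ_of_forall fun x =>
      ⟨W x, hW.mem_Ioo_of_closure_range hrange x, Function.leftInverse_invFun hW.injective x⟩
  intro s hs
  exact ((hW.strictMonoOn_invFun hcont hrange).continuousAt_of_image_mem_nhds
    (Ioo_mem_nhds hs.1 hs.2) (by simp [himage])).continuousWithinAt

end RangeClosure

/-- **Convex acquisition costs for second-price auctions.**  Let `W` be strictly increasing
and continuously differentiable with `W ≥ 0`, `x·W(x) → 0` as `x → −∞`, and closure of range
`[0, B]` for some `0 < B < ∞`.  With the second-price cost
`f(x) = 1_{x ≥ 0} ∫_0^x u W'(u) du` and the acquisition cost `Λ = f ∘ W⁻¹`, we have on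
`(0, B)`:
(i) `Λ(s) = 1_{s ≥ W 0} ∫_{W 0}^s W⁻¹(y) dy`;
(ii) `Λ(s) = 0` for `s ≤ W 0`, and `Λ(s) → 0` as `s → 0⁺`;
(iii) `Λ` is continuously differentiable with `Λ'(s) = 1_{s ≥ W 0}·W⁻¹(s)`;
(iv) `Λ` is convex and nondecreasing. -/
theorem stmt7 (W : ℝ → ℝ) (hW : StrictMono W) (hW1 : ContDiff ℝ 1 W)
    (hWpos : ∀ x, 0 ≤ W x)
    (hWbot : Tendsto (fun x => x * W x) atBot (nhds 0))
    (B : ℝ) (hB : 0 < B) (hrange : closure (Set.range W) = Set.Icc 0 B)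
    (f : ℝ → ℝ)
    (hf : ∀ x : ℝ, f x = if 0 ≤ x then ∫ u in (0 : ℝ)..x, u * deriv W u else 0)
    (Λ : ℝ → ℝ) (hΛ : ∀ s, Λ s = f (Function.invFun W s)) :
    (∀ s ∈ Set.Ioo (0 : ℝ) B,
        Λ s = if W 0 ≤ s then ∫ y in (W 0)..s, Function.invFun W y else 0)
    ∧ (∀ s ∈ Set.Ioo (0 : ℝ) B, s ≤ W 0 → Λ s = 0)
    ∧ Tendsto Λ (nhdsWithin 0 (Set.Ioi 0)) (nhds 0)
    ∧ (∀ s ∈ Set.Ioo (0 : ℝ) B,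
        HasDerivAt Λ (if W 0 ≤ s then Function.invFun W s else 0) s)
    ∧ ContinuousOn (fun s => if W 0 ≤ s then Function.invFun W s else 0) (Set.Ioo 0 B)
    ∧ ConvexOn ℝ (Set.Ioo 0 B) Λ
    ∧ MonotoneOn Λ (Set.Ioo 0 B) := by
  have hcont : Continuous W := hW1.continuous
  set g := Function.invFun W
  have hgW : ∀ x, g (W x) = x := Function.leftInverse_invFun hW.injective
  have hWg : ∀ s ∈ Set.Ioo 0 B, W (g s) = s := fun s hs =>
    apply_invFun_of_closure_range hcont hrange hs
  have hgmono : StrictMonoOn g (Set.Ioo 0 B) := hW.strictMonoOn_invFun hcont hrange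
  have hgcont : ContinuousOn g (Set.Ioo 0 B) := hW.continuousOn_invFun hcont hrange
  have hW0 : W 0 ∈ Set.Ioo 0 B := hW.mem_Ioo_of_closure_range hrange 0
  have hg_nonneg : ∀ s ∈ Set.Ioo 0 B, (0 ≤ g s ↔ W 0 ≤ s) := fun s hs => by
    rw [← hW.le_iff_le, hWg s hs]
  have hΛ_int : ∀ s ∈ Set.Ioo 0 B, Λ s = if W 0 ≤ s then ∫ y in (W 0)..s, g y else 0 := by
    intro s hs
    simp only [hΛ, hf, hg_nonneg s hs]
    congr 1
    have h := intervalIntegral.integral_comp_mul_deriv' (a := 0) (b := g s) (f := W)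
      (f' := deriv W) (g := g)
      (fun x _ => (hW1.differentiable one_ne_zero x).hasDerivAt)
      (hW1.continuous_deriv le_rfl).continuousOn
      (hgcont.mono (by
        rintro _ ⟨x, -, rfl⟩
        exact hW.mem_Ioo_of_closure_range hrange x))
    simpa only [Function.comp_apply, hgW, hWg s hs] using h
  have hΛ_zero : ∀ s ∈ Set.Ioo 0 B, s ≤ W 0 → Λ s = 0 := by
    intro s hs hle
    rw [hΛ_int s hs]
    split_ifs with h
    · rw [le_antisymm hle h, intervalIntegral.integral_same]
    · rfl
  have hmax : ∀ s ∈ Set.Ioo 0 B, (if W 0 ≤ s then g s else 0) = max (g s) 0 := by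
    intro s hs
    simp only [← hg_nonneg s hs]
    split_ifs with h
    · exact (max_eq_left h).symm
    · exact (max_eq_right (not_le.1 h).le).symm
  have hmax_cont : ContinuousOn (fun s => max (g s) 0) (Set.Ioo 0 B) :=
    hgcont.sup continuousOn_const
  have hΛ_max : ∀ s ∈ Set.Ioo 0 B, Λ s = ∫ y in (W 0)..s, max (g y) 0 := by
    intro s hs
    have hsub : Set.uIcc (W 0) s ⊆ Set.Ioo 0 B := Set.ordConnected_Ioo.uIcc_subset hW0 hs
    rcases le_total (W 0) s with h | h
    · rw [hΛ_int s hs, if_pos h]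
      refine intervalIntegral.integral_congr fun y hy => ?_
      have hy' := hsub hy
      rw [Set.uIcc_of_le h] at hy
      exact (max_eq_left ((hg_nonneg y hy').2 hy.1)).symm
    · rw [hΛ_zero s hs h]
      refine (intervalIntegral.integral_zero_ae (ae_of_all _ fun y hy => ?_)).symm
      have hy' := Set.uIoc_subset_uIcc hy
      have hyB := hsub hy'
      rw [Set.uIcc_of_ge h] at hy'
      have := hgmono.monotoneOn hyB hW0 hy'.2
      rw [hgW] at this
      exact max_eq_right this
  have hderiv : ∀ s ∈ Set.Ioo 0 B, HasDerivAt Λ (max (g s) 0) s := by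
    intro s hs
    have hnhds := Ioo_mem_nhds hs.1 hs.2
    refine HasDerivAt.congr_of_eventuallyEq ?_ (eventually_of_mem hnhds hΛ_max)
    exact intervalIntegral.integral_hasDerivAt_right
      (hmax_cont.mono (Set.ordConnected_Ioo.uIcc_subset hW0 hs)).intervalIntegrable
      (hmax_cont.stronglyMeasurableAtFilter isOpen_Ioo s hs)
      (hmax_cont.continuousAt hnhds)
  have hΛ_cont : ContinuousOn Λ (Set.Ioo 0 B) := fun s hs =>
    (hderiv s hs).continuousAt.continuousWithinAt
  refine ⟨hΛ_int, hΛ_zero, ?_, fun s hs => hmax s hs ▸ hderiv s hs, hmax_cont.congr hmax, ?_, ?_⟩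
  · refine tendsto_const_nhds.congr' (eventually_of_mem (Ioo_mem_nhdsGT hW0.1) fun s hs => ?_)
    exact (hΛ_zero s ⟨hs.1, hs.2.trans hW0.2⟩ hs.2.le).symm
  · refine MonotoneOn.convexOn_of_deriv (convex_Ioo 0 B) hΛ_cont ?_ ?_
    · rw [interior_Ioo]
      exact fun s hs => (hderiv s hs).differentiableAt.differentiableWithinAt
    · rw [interior_Ioo]
      intro s hs t ht hst
      rw [(hderiv s hs).deriv, (hderiv t ht).deriv]
      exact max_le_max_right 0 (hgmono.monotoneOn hs ht hst)
  · refine monotoneOn_of_deriv_nonneg (convex_Ioo 0 B) hΛ_cont ?_ ?_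
    · rw [interior_Ioo]
      exact fun s hs => (hderiv s hs).differentiableAt.differentiableWithinAt
    · rw [interior_Ioo]
      intro s hs
      rw [(hderiv s hs).deriv]
      exact le_max_right _ _
end

section
/- Let W : ℝ → ℝ be strictly increasing and continuously differentiable with W(x) ≥ 0, x·W(x) → 0 as x → −∞, and closure of range equal to [0, 1]. Let λ > 0, T > 0, C > 0 with C/(λT) in the range of W. Define f(x) := 1_{x ≥ 0} ∫_0^x u W'(u) du. Then for every measurable x : [0,T] → ℝ satisfying λ ∫_0^T W(x(t)) dt ≥ C, one has ∫_0^T f(x(t)) dt ≥ T·f(W^{−1}(C/(λT))); moreover, the constant bid path x(t) ≡ W^{−1}(C/(λT)) satisfies the supply constraint with equality and attains this lower bound. Hence a constant bid is optimal for the single-contract, single-item-type, time-homogeneous problem. -/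
open MeasureTheory Filter

/-- A weighted form of the mean value inequality: the Stieltjes integral of the identity against
a monotone `C¹` function dominates its value with the weight frozen at the base point `p`. -/
theorem mul_sub_le_integral_mul_deriv {W : ℝ → ℝ} (hW : Monotone W) (hW1 : ContDiff ℝ 1 W)
    (p q : ℝ) : p * (W q - W p) ≤ ∫ u in p..q, u * deriv W u := by
  have hd : Continuous (deriv W) := hW1.continuous_deriv le_rfl
  have hnn : ∀ u, 0 ≤ deriv W u := fun u => hW.deriv_nonneg
  have hftc : ∫ u in p..q, deriv W u = W q - W p :=
    intervalIntegral.integral_deriv_eq_sub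
      (fun u _ => (hW1.differentiable one_ne_zero).differentiableAt) (hd.intervalIntegrable _ _)
  have hsplit : ∫ u in p..q, (u - p) * deriv W u
      = (∫ u in p..q, u * deriv W u) - p * (W q - W p) := by
    have hu : Continuous fun u => u * deriv W u := continuous_id.mul hd
    have hp : Continuous fun u => p * deriv W u := continuous_const.mul hd
    rw [← hftc, ← intervalIntegral.integral_const_mul, ← intervalIntegral.integral_sub
      (hu.intervalIntegrable _ _) (hp.intervalIntegrable _ _)]
    simp only [sub_mul]
  suffices 0 ≤ ∫ u in p..q, (u - p) * deriv W u by linarith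
  rcases le_total p q with h | h
  · exact intervalIntegral.integral_nonneg h
      fun u hu => mul_nonneg (sub_nonneg.2 hu.1) (hnn u)
  · rw [intervalIntegral.integral_symm, ← intervalIntegral.integral_neg]
    exact intervalIntegral.integral_nonneg h fun u hu =>
      neg_nonneg.2 (mul_nonpos_of_nonpos_of_nonneg (sub_nonpos.2 hu.2) (hnn u))

/-- The second-price cost lies above its tangent, as a function of the win probability. -/
theorem cost_add_mul_sub_le {W : ℝ → ℝ} (hW : Monotone W) (hW1 : ContDiff ℝ 1 W) {f : ℝ → ℝ}
    (hf : ∀ x : ℝ, f x = if 0 ≤ x then ∫ u in (0 : ℝ)..x, u * deriv W u else 0) (a y : ℝ) :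
    f a + max a 0 * (W y - W a) ≤ f y := by
  have hf' : ∀ x, f x = ∫ u in (0 : ℝ)..max x 0, u * deriv W u := by
    intro x
    rw [hf]
    split_ifs with h
    · rw [max_eq_left h]
    · rw [max_eq_right (not_le.1 h).le, intervalIntegral.integral_same]
  have hint : ∀ p q : ℝ, IntervalIntegrable (fun u => u * deriv W u) volume p q := fun p q =>
    (continuous_id.mul (hW1.continuous_deriv le_rfl)).intervalIntegrable p q
  have hsub := intervalIntegral.integral_interval_sub_left (hint 0 (max y 0)) (hint 0 (max a 0))
  rw [← hf', ← hf'] at hsub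
  have hkey := mul_sub_le_integral_mul_deriv hW hW1 (max a 0) (max y 0)
  have hslope : max a 0 * (W y - W a) ≤ max a 0 * (W (max y 0) - W (max a 0)) := by
    rcases le_total 0 a with h | h
    · rw [max_eq_left h]
      exact mul_le_mul_of_nonneg_left (sub_le_sub_right (hW (le_max_left _ _)) _) h
    · simp [max_eq_right h]
  linarith

/-- **Optimality of the constant bid** for the single-contract, single-item-type,
time-homogeneous problem.  With supply curve `W` (strictly increasing, `C¹`, nonnegative,
`x·W(x) → 0` at `−∞`, closure of range `[0,1]`), arrival rate `λ > 0`, horizon `T > 0` and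
requirement `C > 0` with `C/(λT)` in the range of `W`, every measurable bid path `x(·)`
(with integrable cost) satisfying the supply constraint `λ∫_0^T W(x(t)) dt ≥ C` has cost
`∫_0^T f(x(t)) dt ≥ T·f(W⁻¹(C/(λT)))`, and the constant bid `x ≡ W⁻¹(C/(λT))` meets the
constraint with equality and attains this bound. -/
theorem stmt8 (W : ℝ → ℝ) (hW : StrictMono W) (hW1 : ContDiff ℝ 1 W)
    (hWpos : ∀ x, 0 ≤ W x)
    (hWbot : Tendsto (fun x => x * W x) atBot (nhds 0))
    (hrange : closure (Set.range W) = Set.Icc 0 1)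
    (lam T C : ℝ) (hlam : 0 < lam) (hT : 0 < T) (hC : 0 < C)
    (hfeas : C / (lam * T) ∈ Set.range W)
    (f : ℝ → ℝ)
    (hf : ∀ x : ℝ, f x = if 0 ≤ x then ∫ u in (0 : ℝ)..x, u * deriv W u else 0) :
    (∀ x : ℝ → ℝ, Measurable x →
      IntegrableOn (fun t => f (x t)) (Set.Ioc 0 T) →
      C ≤ lam * ∫ t in Set.Ioc (0 : ℝ) T, W (x t) →
      T * f (Function.invFun W (C / (lam * T))) ≤ ∫ t in Set.Ioc (0 : ℝ) T, f (x t))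
    ∧ lam * (∫ _t in Set.Ioc (0 : ℝ) T, W (Function.invFun W (C / (lam * T)))) = C
    ∧ (∫ _t in Set.Ioc (0 : ℝ) T, f (Function.invFun W (C / (lam * T))))
        = T * f (Function.invFun W (C / (lam * T))) := by
  obtain ⟨a, ha⟩ := hfeas
  have hinv : Function.invFun W (C / (lam * T)) = a := by
    rw [← ha]
    exact Function.leftInverse_invFun hW.injective a
  have hWa : lam * (T * W a) = C := by
    rw [ha]
    field_simp
  rw [hinv]
  refine ⟨fun x hx hfx hsupply => ?_, ?_, ?_⟩
  · have hle : ∀ y, W y ≤ 1 := fun y =>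
      (hrange ▸ subset_closure (Set.mem_range_self y) : W y ∈ Set.Icc (0 : ℝ) 1).2
    have hWx : IntegrableOn (fun t => W (x t)) (Set.Ioc 0 T) :=
      Measure.integrableOn_of_bounded (M := 1) (by simp)
        (hW1.continuous.measurable.comp hx).aestronglyMeasurable
        (ae_of_all _ fun t => by
          rw [Real.norm_of_nonneg (hWpos _)]
          exact hle _)
    have hconst : ∀ c : ℝ, IntegrableOn (fun _ => c) (Set.Ioc 0 T) := fun c =>
      integrableOn_const (by simp)
    have hdiff : IntegrableOn (fun t => W (x t) - W a) (Set.Ioc 0 T) := hWx.sub (hconst _)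
    have hmono : ∫ t in Set.Ioc (0 : ℝ) T, (f a + max a 0 * (W (x t) - W a))
        ≤ ∫ t in Set.Ioc (0 : ℝ) T, f (x t) :=
      integral_mono ((hconst _).add (hdiff.const_mul _)) hfx
        fun t => cost_add_mul_sub_le hW.monotone hW1 hf a (x t)
    rw [integral_add (hconst _) (hdiff.const_mul _), integral_const_mul,
      integral_sub hWx (hconst _)] at hmono
    simp only [setIntegral_const, Real.volume_real_Ioc_of_le hT.le, sub_zero, smul_eq_mul]
      at hmono
    have hexcess : 0 ≤ (∫ t in Set.Ioc (0 : ℝ) T, W (x t)) - T * W a :=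
      sub_nonneg.2 (le_of_mul_le_mul_left (hWa.trans_le hsupply) hlam)
    linarith [mul_nonneg (le_max_right a 0) hexcess]
  · simpa [Real.volume_real_Ioc_of_le hT.le] using hWa
  · simp [Real.volume_real_Ioc_of_le hT.le]
end
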